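/- Let 𝒟̃ be a convex set of nonnegative functions in L¹(Ω, 𝓕, P), and let Q ∈ (L^∞)^* be a positive functional belonging to the weak-star closure of the canonical embedding of 𝒟̃ into (L^∞)^*. Assume Q = Q^r + Q^s, where Q^r is the canonical embedding of some nonnegative g ∈ L¹(Ω, 𝓕, P), Q^s ∈ (L^∞)^* is positive, and for every ε > 0 there exists A ∈ 𝓕 with P(A) > 1 − ε and ⟨Q^s, 1_A⟩ = 0. Let (f_i)_{i∈ℕ} be a sequence in L^∞. Then there exists a sequence (h^n)_{n∈ℕ} in 𝒟̃ such that h^n → g P-a.s. as n → ∞ and, for every i ∈ ℕ, E[h^n f_i] → ⟨Q, f_i⟩ as n → ∞. -/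

import Mathlib

open MeasureTheory Filter Topology

namespace MeasureTheory

variable {Ω : Type*} [MeasurableSpace Ω] {P : Measure Ω}

/-- Every continuous functional on `L¹` of a finite measure is integration against a function
in `L^∞`. -/
theorem exists_Lp_top_forall_eq_integral_mul [IsFiniteMeasure P] (φ : Lp ℝ 1 P →L[ℝ] ℝ) :
    ∃ k : Lp ℝ ⊤ P, ∀ f : Lp ℝ 1 P, φ f = ∫ ω, k ω * f ω ∂P := by
  have h21 : ∀ f : Lp ℝ 2 P, MemLp f 1 P := fun f => (Lp.memLp f).mono_exponent (by norm_num)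
  let T : Lp ℝ 2 P →ₗ[ℝ] Lp ℝ 1 P :=
    { toFun := fun f => (h21 f).toLp f
      map_add' := fun f g => by
        rw [← MemLp.toLp_add]
        exact MemLp.toLp_congr _ _ (Lp.coeFn_add f g)
      map_smul' := fun c f => by
        rw [RingHom.id_apply, ← MemLp.toLp_const_smul]
        exact MemLp.toLp_congr _ _ (Lp.coeFn_smul c f) }
  obtain ⟨C, hC⟩ : ∃ C : ENNReal, C ≠ ⊤ ∧ ∀ f : Lp ℝ 2 P, eLpNorm f 1 P ≤ eLpNorm f 2 P * C :=
    ⟨P Set.univ ^ (1 / (1 : ENNReal).toReal - 1 / (2 : ENNReal).toReal), by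
      refine ENNReal.rpow_ne_top_of_nonneg (by norm_num) (measure_ne_top _ _), fun f =>
      eLpNorm_le_eLpNorm_mul_rpow_measure_univ (by norm_num) (Lp.aestronglyMeasurable f)⟩
  let T' : Lp ℝ 2 P →L[ℝ] Lp ℝ 1 P := T.mkContinuous C.toReal fun f => by
    change ‖(h21 f).toLp f‖ ≤ _
    rw [Lp.norm_toLp, Lp.norm_def, mul_comm, ← ENNReal.toReal_mul]
    exact ENNReal.toReal_mono (ENNReal.mul_ne_top (Lp.eLpNorm_ne_top f) hC.1) (hC.2 f)
  let k := (InnerProductSpace.toDual ℝ (Lp ℝ 2 P)).symm (φ.comp T')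
  have hk : ∀ f : Lp ℝ 2 P, inner ℝ k f = φ (T' f) := fun f => by
    simp [k]
  have hkint : Integrable k P := memLp_one_iff_integrable.1 (h21 k)
  have hset : ∀ s (hs : MeasurableSet s),
      ∫ ω in s, k ω ∂P = φ (indicatorConstLp 1 hs (measure_ne_top P s) (1 : ℝ)) := by
    intro s hs
    rw [← L2.inner_indicatorConstLp_one hs (measure_ne_top P s) k, real_inner_comm, hk]
    congr 1
    exact MemLp.toLp_congr (h21 _) _ indicatorConstLp_coeFn
  have hbd : ∀ s (hs : MeasurableSet s), |∫ ω in s, k ω ∂P| ≤ ∫ _ in s, ‖φ‖ ∂P := by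
    intro s hs
    rw [hset s hs]
    refine (φ.le_opNorm _).trans ?_
    rw [norm_indicatorConstLp one_ne_zero ENNReal.one_ne_top]
    simp [mul_comm, Measure.real]
  have hle : ∀ᵐ ω ∂P, k ω ≤ ‖φ‖ :=
    ae_le_of_forall_setIntegral_le hkint (integrable_const _) fun s hs _ =>
      (le_abs_self _).trans (hbd s hs)
  have hge : ∀ᵐ ω ∂P, -‖φ‖ ≤ k ω :=
    ae_le_of_forall_setIntegral_le (integrable_const _) hkint fun s hs _ => by
      rw [integral_neg]
      exact neg_le_of_abs_le (hbd s hs)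
  have hktop : MemLp k ⊤ P := memLp_top_of_bound (Lp.aestronglyMeasurable k) ‖φ‖ (by
    filter_upwards [hle, hge] with ω h1 h2
    exact abs_le.2 ⟨h2, h1⟩)
  let ψ : Lp ℝ 1 P →L[ℝ] ℝ :=
    (ContinuousLinearMap.mul ℝ ℝ).lpPairing P ⊤ 1 (hktop.toLp k)
  have hψ : ∀ f, ψ f = ∫ ω, k ω * f ω ∂P := fun f => by
    simp only [ψ]
    rw [ContinuousLinearMap.lpPairing_eq_integral]
    refine integral_congr_ae ?_
    filter_upwards [hktop.coeFn_toLp] with ω h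
    simp [h]
  suffices hφψ : ∀ f, φ f = ψ f by
    refine ⟨hktop.toLp k, fun f => ?_⟩
    rw [hφψ]
    exact ContinuousLinearMap.lpPairing_eq_integral _ _ _
  intro f
  induction f using Lp.induction ENNReal.one_ne_top with
  | indicatorConst c hs hμs =>
    rename_i s
    rw [Lp.simpleFunc.coe_indicatorConst]
    have : indicatorConstLp 1 hs hμs.ne c
        = c • indicatorConstLp 1 hs (measure_ne_top P s) (1 : ℝ) := by
      rw [indicatorConstLp, indicatorConstLp, ← MemLp.toLp_const_smul]
      refine MemLp.toLp_congr _ _ (.of_forall fun ω => ?_)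
      by_cases hω : ω ∈ s <;> simp [hω]
    rw [this, map_smul, map_smul, ← hset s hs, hψ]
    congr 1
    rw [← integral_indicator hs]
    refine integral_congr_ae ?_
    filter_upwards [indicatorConstLp_coeFn (p := 1) (hs := hs) (hμs := measure_ne_top P s)
      (c := (1 : ℝ))] with ω h
    rw [h]
    by_cases hω : ω ∈ s <;> simp [hω]
  | add hf hg _ h1 h2 =>
    rw [map_add, map_add, h1, h2]
  | isClosed => exact isClosed_eq φ.continuous ψ.continuous

/-- A positive functional on `L^∞` vanishing on the indicator of `A` vanishes on every function
supported in `A`. -/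
theorem apply_eq_zero_of_apply_indicatorConstLp_eq_zero [IsFiniteMeasure P]
    {q : WeakDual ℝ (Lp ℝ ⊤ P)}
    (hq : ∀ f : Lp ℝ ⊤ P, (∀ᵐ ω ∂P, 0 ≤ f ω) → 0 ≤ q f)
    {A : Set Ω} (hA : MeasurableSet A)
    (hqA : q (indicatorConstLp ⊤ hA (measure_ne_top P A) (1 : ℝ)) = 0)
    {f : Lp ℝ ⊤ P} (hf : ∀ᵐ ω ∂P, ω ∉ A → f ω = 0) : q f = 0 := by
  set e := indicatorConstLp ⊤ hA (measure_ne_top P A) (1 : ℝ) with he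
  have hb : ∀ᵐ ω ∂P, |f ω| ≤ ‖f‖ := by
    filter_upwards [ae_le_eLpNormEssSup (f := f) (μ := P)] with ω h
    rw [Lp.norm_def, eLpNorm_exponent_top, ← Real.norm_eq_abs, ← toReal_enorm]
    refine ENNReal.toReal_mono ?_ h
    simpa using Lp.eLpNorm_ne_top f
  have h1 : 0 ≤ q (‖f‖ • e - f) := hq _ <| by
    filter_upwards [hb, hf, Lp.coeFn_sub (‖f‖ • e) f, Lp.coeFn_smul ‖f‖ e,
      indicatorConstLp_coeFn (p := ⊤) (hs := hA) (hμs := measure_ne_top P A) (c := (1 : ℝ))]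
      with ω h1 h2 h3 h4 h5
    rw [h3, Pi.sub_apply, h4, Pi.smul_apply, h5]
    by_cases hω : ω ∈ A
    · simpa [hω] using (abs_le.1 h1).2
    · simp [hω, h2 hω]
  have h2 : 0 ≤ q (‖f‖ • e + f) := hq _ <| by
    filter_upwards [hb, hf, Lp.coeFn_add (‖f‖ • e) f, Lp.coeFn_smul ‖f‖ e,
      indicatorConstLp_coeFn (p := ⊤) (hs := hA) (hμs := measure_ne_top P A) (c := (1 : ℝ))]
      with ω h1 h2 h3 h4 h5
    rw [h3, Pi.add_apply, h4, Pi.smul_apply, h5]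
    by_cases hω : ω ∈ A
    · simp [hω]; linarith [(abs_le.1 h1).1]
    · simp [hω, h2 hω]
  rw [map_sub, map_smul, hqA] at h1
  rw [map_add, map_smul, hqA] at h2
  simp at h1 h2
  exact le_antisymm h1 h2

theorem integrable_Lp_top_mul (f : Lp ℝ ⊤ P) {h : Ω → ℝ} (hh : Integrable h P) :
    Integrable (fun ω => f ω * h ω) P :=
  memLp_one_iff_integrable.1 ((memLp_one_iff_integrable.2 hh).mul (Lp.memLp f))

/-- If `Q = Qr + Qs` is a weak-star limit point of the convex set `D`, where `Qr` is integration
against `g` and `Qs` is positive and vanishes on `A`, then some element of `D` is close to `g`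
in `L¹(A)` and close to `Q` when tested against finitely many bounded functions. -/
theorem exists_mem_eLpNorm_indicator_sub_lt [IsFiniteMeasure P] {D : Set (Ω → ℝ)}
    (hD : ∀ h ∈ D, Integrable h P) (hDconv : Convex ℝ D) {Q Qr Qs : WeakDual ℝ (Lp ℝ ⊤ P)}
    (hQ : Q ∈ closure {q : WeakDual ℝ (Lp ℝ ⊤ P) |
      ∃ h ∈ D, ∀ f : Lp ℝ ⊤ P, q f = ∫ ω, f ω * h ω ∂P})
    {g : Ω → ℝ} (hg : Integrable g P) (hdecomp : Q = Qr + Qs)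
    (hQr : ∀ f : Lp ℝ ⊤ P, Qr f = ∫ ω, f ω * g ω ∂P)
    (hQs : ∀ f : Lp ℝ ⊤ P, (∀ᵐ ω ∂P, 0 ≤ f ω) → 0 ≤ Qs f)
    {A : Set Ω} (hA : MeasurableSet A)
    (hQsA : Qs (indicatorConstLp ⊤ hA (measure_ne_top P A) (1 : ℝ)) = 0)
    {ι : Type*} [Fintype ι] (F : ι → Lp ℝ ⊤ P) {δ : ℝ} (hδ : 0 < δ) :
    ∃ h ∈ D, eLpNorm (A.indicator (h - g)) 1 P < ENNReal.ofReal δ ∧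
      ∀ i, |∫ ω, h ω * F i ω ∂P - Q (F i)| < δ := by
  classical
  let S : Set (Lp ℝ 1 P × (ι → ℝ)) := {x | ∃ h ∈ D, x.1 =ᵐ[P] A.indicator h ∧
    ∀ i, x.2 i = ∫ ω, F i ω * h ω ∂P}
  have hS : Convex ℝ S := by
    rintro x ⟨h, hh, hx1, hx2⟩ y ⟨h', hh', hy1, hy2⟩ a b ha hb hab
    refine ⟨a • h + b • h', hDconv hh hh' ha hb hab, ?_, fun i => ?_⟩
    · filter_upwards [hx1, hy1, Lp.coeFn_add (a • x.1) (b • y.1), Lp.coeFn_smul a x.1,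
        Lp.coeFn_smul b y.1] with ω h1 h2 h3 h4 h5
      change (a • x.1 + b • y.1 : Lp ℝ 1 P) ω = _
      rw [h3, Pi.add_apply, h4, h5, Pi.smul_apply, Pi.smul_apply, h1, h2]
      by_cases hω : ω ∈ A <;> simp [hω]
    · change a * x.2 i + b * y.2 i = _
      rw [hx2, hy2, ← integral_const_mul, ← integral_const_mul, ← integral_add
        ((integrable_Lp_top_mul _ (hD h hh)).const_mul a)
        ((integrable_Lp_top_mul _ (hD h' hh')).const_mul b)]
      refine integral_congr_ae (.of_forall fun ω => ?_)
      simp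
      ring
  have hgA : MemLp (A.indicator g) 1 P := memLp_one_iff_integrable.2 (hg.indicator hA)
  let p : Lp ℝ 1 P × (ι → ℝ) := (hgA.toLp _, fun i => Q (F i))
  have hp : p ∈ closure S := by
    by_contra hp
    obtain ⟨φ, u, hφ, hu⟩ := geometric_hahn_banach_closed_point hS.closure isClosed_closure hp
    obtain ⟨k, hk⟩ := exists_Lp_top_forall_eq_integral_mul
      (φ.comp (ContinuousLinearMap.inl ℝ (Lp ℝ 1 P) (ι → ℝ)))
    let c : ι → ℝ := fun i => φ (0, Pi.single i 1)
    have hφ_eq : ∀ x, φ x = ∫ ω, k ω * x.1 ω ∂P + ∑ i, c i * x.2 i := by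
      intro x
      rw [← hk]
      have h2 : φ (0, x.2) = ∑ i, c i * x.2 i := by
        have := (φ.comp
          (ContinuousLinearMap.inr ℝ (Lp ℝ 1 P) (ι → ℝ))).toLinearMap.pi_apply_eq_sum_univ x.2
        simp only [ContinuousLinearMap.coe_coe, ContinuousLinearMap.comp_apply,
          ContinuousLinearMap.inr_apply] at this
        rw [this]
        refine Finset.sum_congr rfl fun i _ => ?_
        rw [smul_eq_mul, mul_comm]
        congr 4
        ext j
        simp [Pi.single_apply, eq_comm]
      rw [← h2]
      simp only [ContinuousLinearMap.comp_apply, ContinuousLinearMap.inl_apply]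
      rw [← map_add]
      simp
    have hkA : MemLp (A.indicator k) ⊤ P := (Lp.memLp k).indicator hA
    let kA : Lp ℝ ⊤ P := hkA.toLp _
    have hkA_int : ∀ {h h' : Ω → ℝ}, h' =ᵐ[P] A.indicator h →
        ∫ ω, kA ω * h ω ∂P = ∫ ω, k ω * h' ω ∂P := by
      intro h h' hh
      refine integral_congr_ae ?_
      filter_upwards [hkA.coeFn_toLp, hh] with ω h1 h2
      rw [h1, h2]
      by_cases hω : ω ∈ A <;> simp [hω]
    let f₀ : Lp ℝ ⊤ P := kA + ∑ i, c i • F i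
    have hf₀ : ∀ q : WeakDual ℝ (Lp ℝ ⊤ P), q f₀ = q kA + ∑ i, c i * q (F i) := fun q => by
      simp [f₀]
    have hle : Q f₀ ≤ u := by
      have hcl : IsClosed {q : WeakDual ℝ (Lp ℝ ⊤ P) | q f₀ ≤ u} :=
        isClosed_le (WeakDual.eval_continuous f₀) continuous_const
      refine closure_minimal ?_ hcl hQ
      rintro q ⟨h, hh, hq⟩
      have hhA : MemLp (A.indicator h) 1 P :=
        memLp_one_iff_integrable.2 ((hD h hh).indicator hA)
      have := hφ (hhA.toLp _, fun i => q (F i))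
        (subset_closure ⟨h, hh, hhA.coeFn_toLp, fun i => hq _⟩)
      rw [hφ_eq] at this
      rw [Set.mem_ofPred_eq, hf₀, hq kA, hkA_int hhA.coeFn_toLp]
      exact this.le
    have hQskA : Qs kA = 0 := by
      refine apply_eq_zero_of_apply_indicatorConstLp_eq_zero hQs hA hQsA ?_
      filter_upwards [hkA.coeFn_toLp] with ω h hω
      rw [h]
      simp [hω]
    have hQkA : Q kA = ∫ ω, k ω * p.1 ω ∂P := by
      rw [hdecomp]
      change Qr kA + Qs kA = _
      rw [hQskA, add_zero, hQr, hkA_int hgA.coeFn_toLp]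
    rw [hφ_eq, ← hQkA, ← hf₀] at hu
    exact hu.not_ge hle
  obtain ⟨x, ⟨h, hh, hx1, hx2⟩, hdist⟩ := Metric.mem_closure_iff.1 hp δ hδ
  rw [dist_comm, Prod.dist_eq, max_lt_iff] at hdist
  refine ⟨h, hh, ?_, fun i => ?_⟩
  · have h1 : eLpNorm (A.indicator (h - g)) 1 P = edist x.1 p.1 := by
      rw [Lp.edist_def]
      refine eLpNorm_congr_ae ?_
      filter_upwards [hx1, hgA.coeFn_toLp] with ω h1 h2
      rw [Pi.sub_apply, h1, h2]
      by_cases hω : ω ∈ A <;> simp [hω]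
    rw [h1, edist_dist]
    exact (ENNReal.ofReal_lt_ofReal_iff hδ).2 hdist.1
  · have := (dist_le_pi_dist x.2 p.2 i).trans_lt hdist.2
    rw [hx2, Real.dist_eq] at this
    simpa only [mul_comm] using this

/-- Functions that converge to `g` in `L¹` on sets of asymptotically full measure converge to `g`
in measure. -/
theorem tendstoInMeasure_of_tendsto_eLpNorm_indicator {h : ℕ → Ω → ℝ} {g : Ω → ℝ}
    {A : ℕ → Set Ω} (hA : ∀ n, MeasurableSet (A n))
    (hh : ∀ n, AEStronglyMeasurable (h n) P) (hg : AEStronglyMeasurable g P)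
    (hAc : Tendsto (fun n => P (A n)ᶜ) atTop (𝓝 0))
    (hL : Tendsto (fun n => eLpNorm ((A n).indicator (h n - g)) 1 P) atTop (𝓝 0)) :
    TendstoInMeasure P h atTop g := by
  have h0 : TendstoInMeasure P (fun n => (A n).indicator (h n - g)) atTop (0 : Ω → ℝ) :=
    tendstoInMeasure_of_tendsto_eLpNorm one_ne_zero
      (fun n => ((hh n).sub hg).indicator (hA n)) aestronglyMeasurable_zero (by simpa using hL)
  intro ε hε
  have hsum := (h0 ε hε).add hAc
  rw [add_zero] at hsum
  refine tendsto_of_tendsto_of_tendsto_of_le_of_le tendsto_const_nhds hsum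
    (fun _ => zero_le) fun n => ?_
  refine (measure_mono fun ω hω => ?_).trans (measure_union_le _ _)
  by_cases hωA : ω ∈ A n
  · left
    simpa [hωA, edist_eq_enorm_sub] using hω
  · exact Or.inr hωA

end MeasureTheory

/-- Proposition 5.1: if `Q` lies in the weak-star closure (in `(L^∞)^*`) of the canonical
embedding of a convex set `D` of nonnegative `L¹` functions, and `Q = Qr + Qs` is its
Yosida–Hewitt decomposition with regular part given by integration against `g ∈ L¹`,
then some sequence from `D` converges to `g` almost surely and, tested against countably
many bounded functions `F i`, also converges to the corresponding values of `Q` (Corollary 5.2). -/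
theorem exists_seq_tendsto_ae_and_eval_of_mem_weakStar_closure
    {Ω : Type*} [MeasurableSpace Ω] (P : Measure Ω) [IsProbabilityMeasure P]
    (D : Set (Ω → ℝ))
    (hD : ∀ h ∈ D, Integrable h P ∧ 0 ≤ᵐ[P] h)
    (hDconv : Convex ℝ D)
    (Q Qr Qs : WeakDual ℝ (Lp ℝ ⊤ P))
    (hQpos : ∀ f : Lp ℝ ⊤ P, (∀ᵐ ω ∂P, 0 ≤ f ω) → 0 ≤ Q f)
    (hQclosure : Q ∈ closure {q : WeakDual ℝ (Lp ℝ ⊤ P) |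
      ∃ h ∈ D, ∀ f : Lp ℝ ⊤ P, q f = ∫ ω, f ω * h ω ∂P})
    (g : Ω → ℝ) (hg_int : Integrable g P) (hg_nonneg : 0 ≤ᵐ[P] g)
    (hdecomp : Q = Qr + Qs)
    (hQr : ∀ f : Lp ℝ ⊤ P, Qr f = ∫ ω, f ω * g ω ∂P)
    (hQs_pos : ∀ f : Lp ℝ ⊤ P, (∀ᵐ ω ∂P, 0 ≤ f ω) → 0 ≤ Qs f)
    (hQs_sing : ∀ ε > (0 : ℝ), ∃ A : Set Ω, ∃ hA : MeasurableSet A,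
      (P A).toReal > 1 - ε ∧
      Qs (indicatorConstLp ⊤ hA (measure_ne_top P A) (1 : ℝ)) = 0)
    (F : ℕ → Lp ℝ ⊤ P) :
    ∃ h : ℕ → Ω → ℝ, (∀ n, h n ∈ D) ∧
      (∀ᵐ ω ∂P, Tendsto (fun n => h n ω) atTop (𝓝 (g ω))) ∧
      ∀ i : ℕ, Tendsto (fun n => ∫ ω, h n ω * F i ω ∂P) atTop (𝓝 (Q (F i))) := by
  have hex : ∀ n : ℕ, ∃ A : Set Ω, MeasurableSet A ∧
      P Aᶜ ≤ ENNReal.ofReal (1 / ((n : ℝ) + 1)) ∧ ∃ h ∈ D,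
      eLpNorm (A.indicator (h - g)) 1 P < ENNReal.ofReal (1 / ((n : ℝ) + 1)) ∧
      ∀ i : Fin n, |∫ ω, h ω * F i ω ∂P - Q (F i)| < 1 / ((n : ℝ) + 1) := by
    intro n
    have hpos : 0 < 1 / ((n : ℝ) + 1) := by positivity
    obtain ⟨A, hA, hPA, hQA⟩ := hQs_sing _ hpos
    refine ⟨A, hA, ?_, exists_mem_eLpNorm_indicator_sub_lt (fun h hh => (hD h hh).1) hDconv
      hQclosure hg_int hdecomp hQr hQs_pos hA hQA (fun i : Fin n => F i) hpos⟩
    rw [← ENNReal.ofReal_toReal (measure_ne_top P Aᶜ)]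
    refine ENNReal.ofReal_le_ofReal ?_
    have := probReal_compl_eq_one_sub (μ := P) hA
    simp only [Measure.real] at this
    linarith
  choose A hA hPA h hhD hL hF using hex
  have hlim : Tendsto (fun n : ℕ => ENNReal.ofReal (1 / ((n : ℝ) + 1))) atTop (𝓝 0) := by
    simpa using ENNReal.tendsto_ofReal tendsto_one_div_add_atTop_nhds_zero_nat
  have hmeas : TendstoInMeasure P h atTop g :=
    tendstoInMeasure_of_tendsto_eLpNorm_indicator hA
      (fun n => (hD _ (hhD n)).1.aestronglyMeasurable) hg_int.aestronglyMeasurable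
      (tendsto_of_tendsto_of_tendsto_of_le_of_le tendsto_const_nhds hlim
        (fun _ => zero_le) hPA)
      (tendsto_of_tendsto_of_tendsto_of_le_of_le tendsto_const_nhds hlim
        (fun _ => zero_le) fun n => (hL n).le)
  obtain ⟨ns, hns, hae⟩ := hmeas.exists_seq_tendsto_ae
  refine ⟨fun n => h (ns n), fun n => hhD _, hae, fun i => ?_⟩
  have hi : Tendsto (fun n => ∫ ω, h n ω * F i ω ∂P) atTop (𝓝 (Q (F i))) := by
    rw [tendsto_iff_dist_tendsto_zero]
    refine squeeze_zero' (.of_forall fun _ => dist_nonneg) ?_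
      tendsto_one_div_add_atTop_nhds_zero_nat
    filter_upwards [eventually_gt_atTop i] with n hn
    exact (hF n ⟨i, hn⟩).le
  exact hi.comp hns.tendsto_atTop
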